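/- In dimension N = 2, for every k ≥ 2, the function u_1(θ) = sin(kθ/(2(k-1))) for θ ∈ [0, 2π(k-1)/k] and u_1 = 0 otherwise, together with its rotations u_m(θ) = u_1(θ - (m-1)·2π/k), satisfies ∏_{j=1}^k u_j ≡ 0 on the circle and λ(u_m) = k^2/(4(k-1)^2) for every m, so that α_{k,2} ≤ k^2/(2(k-1)). -/

import Mathlib

open MeasureTheory intervalIntegral

/-- First Dirichlet eigenvalue (Rayleigh-quotient infimum) on the positivity
set of `u` on the circle `ℝ/2πℤ`, over `2π`-periodic test functions vanishing
a.e. on `{u = 0}`. -/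
noncomputable def lamCirc (u : ℝ → ℝ) : ℝ :=
  sInf { c : ℝ | ∃ φ : ℝ → ℝ, ContDiff ℝ 1 φ ∧ Function.Periodic φ (2 * Real.pi) ∧
    volume ({θ | φ θ ≠ 0} ∩ {θ | u θ = 0} ∩ Set.Ico 0 (2 * Real.pi)) = 0 ∧
    0 < ∫ θ in (0 : ℝ)..(2 * Real.pi), (φ θ) ^ 2 ∧
    c = (∫ θ in (0 : ℝ)..(2 * Real.pi), (deriv φ θ) ^ 2) /
        (∫ θ in (0 : ℝ)..(2 * Real.pi), (φ θ) ^ 2) }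

/-- The optimal partial-segregation value on the circle (`N = 2`, where
`γ(t) = √t`): infimum of `∑_j √(λ(u_j))` over `k`-tuples of continuous
`2π`-periodic functions with everywhere-vanishing product. -/
noncomputable def alphaCirc (k : ℕ) : ℝ :=
  sInf { s : ℝ | ∃ u : Fin k → ℝ → ℝ,
    (∀ j, Continuous (u j)) ∧ (∀ j, Function.Periodic (u j) (2 * Real.pi)) ∧
    (∀ θ, ∏ j, u j θ = 0) ∧
    s = ∑ j, Real.sqrt (lamCirc (u j)) }

/-- The truncated power `x ↦ (max x 0) ^ q` is differentiable for `1 < q`. -/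
lemma hasDerivAt_max_zero_rpow {q : ℝ} (hq : 1 < q) (x : ℝ) :
    HasDerivAt (fun y : ℝ => (max y 0) ^ q) (q * (max x 0) ^ (q - 1)) x := by
  rcases lt_trichotomy x 0 with hx | rfl | hx
  · rw [max_eq_right hx.le, Real.zero_rpow (by linarith), mul_zero]
    refine (hasDerivAt_const x (0 : ℝ)).congr_of_eventuallyEq ?_
    filter_upwards [Iio_mem_nhds hx] with y hy
    rw [max_eq_right (le_of_lt hy), Real.zero_rpow (by linarith)]
  · rw [max_self, Real.zero_rpow (by linarith), mul_zero]
    have h1 : HasDerivWithinAt (fun y : ℝ => (max y 0) ^ q) 0 (Set.Iic 0) 0 := by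
      refine (hasDerivWithinAt_const (0 : ℝ) _ (0 : ℝ)).congr ?_ ?_
      · intro y hy
        rw [max_eq_right hy, Real.zero_rpow (by linarith)]
      · rw [max_self, Real.zero_rpow (by linarith)]
    have h2 : HasDerivWithinAt (fun y : ℝ => (max y 0) ^ q) 0 (Set.Ici 0) 0 := by
      have h := (Real.hasDerivAt_rpow_const (x := 0) (p := q) (Or.inr hq.le)).hasDerivWithinAt
        (s := Set.Ici 0)
      rw [Real.zero_rpow (by linarith), mul_zero] at h
      refine h.congr ?_ ?_
      · intro y hy
        rw [max_eq_left hy]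
      · rw [max_self]
    simpa using h1.union h2
  · rw [max_eq_left hx.le]
    refine (Real.hasDerivAt_rpow_const (Or.inl hx.ne')).congr_of_eventuallyEq ?_
    filter_upwards [Ioi_mem_nhds hx] with y hy
    rw [max_eq_left (le_of_lt hy)]

/-- Power of the positive part of a sine wave. -/
noncomputable def sinPosPow (c p t : ℝ) : ℝ := (max (Real.sin (c * t)) 0) ^ p

lemma sinPosPow_of_nonpos {c p t : ℝ} (hp : p ≠ 0) (h : Real.sin (c * t) ≤ 0) :
    sinPosPow c p t = 0 := by
  rw [sinPosPow, max_eq_right h, Real.zero_rpow hp]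

lemma hasDerivAt_sinPosPow {c p : ℝ} (hp : 1 < p) (t : ℝ) :
    HasDerivAt (sinPosPow c p) (p * sinPosPow c (p - 1) t * (Real.cos (c * t) * c)) t := by
  have h1 : HasDerivAt (fun t => Real.sin (c * t)) (Real.cos (c * t) * c) t := by
    simpa using ((hasDerivAt_id t).const_mul c).sin
  exact (hasDerivAt_max_zero_rpow hp (Real.sin (c * t))).comp t h1

lemma continuous_sinPosPow {c p : ℝ} (hp : 0 ≤ p) : Continuous (sinPosPow c p) := by
  unfold sinPosPow
  exact Continuous.rpow_const (by fun_prop) fun _ => Or.inr hp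

lemma contDiff_sinPosPow {c p : ℝ} (hp : 1 < p) : ContDiff ℝ 1 (sinPosPow c p) := by
  rw [contDiff_one_iff_deriv]
  refine ⟨fun t => (hasDerivAt_sinPosPow hp t).differentiableAt, ?_⟩
  rw [show deriv (sinPosPow c p) = _ from funext fun t => (hasDerivAt_sinPosPow hp t).deriv]
  have := continuous_sinPosPow (c := c) (p := p - 1) (by linarith)
  fun_prop

lemma integral_deriv_sinPosPow_sq {c p T : ℝ} (hc : c ≠ 0) (hp : 1 < p)
    (hT : Real.sin (c * T) ≤ 0) :
    ∫ t in (0 : ℝ)..T, (deriv (sinPosPow c p) t) ^ 2 =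
      p ^ 2 * c ^ 2 / (2 * p - 1) * ∫ t in (0 : ℝ)..T, (sinPosPow c p t) ^ 2 := by
  have hq : (1 : ℝ) < 2 * p - 1 := by linarith
  have hsq : ∀ {r t : ℝ}, sinPosPow c r t ^ 2 = sinPosPow c (2 * r) t := fun {r t} => by
    rw [sinPosPow, sinPosPow, mul_comm 2 r, Real.rpow_mul (le_max_right _ _)]
    norm_num
  have hmul : ∀ t, sinPosPow c (2 * p - 1) t * Real.sin (c * t) = sinPosPow c p t ^ 2 := by
    intro t
    rw [hsq]
    rcases le_or_gt (Real.sin (c * t)) 0 with h | h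
    · rw [sinPosPow_of_nonpos (by linarith) h, sinPosPow_of_nonpos (by linarith) h, zero_mul]
    · rw [sinPosPow, sinPosPow, max_eq_left h.le, Real.rpow_sub_one h.ne', div_mul_cancel₀ _ h.ne']
  have hF : ∀ t ∈ Set.uIcc 0 T, HasDerivAt
      (fun t => sinPosPow c (2 * p - 1) t * Real.cos (c * t))
      ((2 * p - 1) / (p ^ 2 * c) * deriv (sinPosPow c p) t ^ 2 - c * sinPosPow c p t ^ 2) t := by
    intro t _
    have h1 : HasDerivAt (fun t => Real.cos (c * t)) (-Real.sin (c * t) * c) t := by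
      simpa using ((hasDerivAt_id t).const_mul c).cos
    refine ((hasDerivAt_sinPosPow hq t).mul h1).congr_deriv ?_
    rw [(hasDerivAt_sinPosPow hp t).deriv, ← hmul t, mul_pow, mul_pow, hsq,
      show 2 * (p - 1) = 2 * p - 1 - 1 by ring]
    have : p ≠ 0 := by linarith
    field_simp
    ring
  have hc1 : Continuous fun t => deriv (sinPosPow c p) t ^ 2 :=
    ((contDiff_sinPosPow hp).continuous_deriv le_rfl).pow 2
  have hc2 : Continuous fun t => sinPosPow c p t ^ 2 :=
    (continuous_sinPosPow (by linarith)).pow 2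
  have key := integral_eq_sub_of_hasDerivAt hF
    (((hc1.const_mul _).sub (hc2.const_mul _)).intervalIntegrable _ _)
  rw [integral_sub ((hc1.const_mul _).intervalIntegrable _ _)
    ((hc2.const_mul _).intervalIntegrable _ _), intervalIntegral.integral_const_mul, intervalIntegral.integral_const_mul,
    sinPosPow_of_nonpos (by linarith) hT, sinPosPow_of_nonpos (by linarith) (by simp)] at key
  have : p ≠ 0 := by linarith
  have : 2 * p - 1 ≠ 0 := by linarith
  field_simp at key ⊢
  linarith

lemma sq_mul_integral_sq_le_of_lt {a b c : ℝ} (hab : a ≤ b) (hc : 0 ≤ c)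
    (hcab : c * (b - a) < Real.pi) {φ : ℝ → ℝ} (hφ : ContDiff ℝ 1 φ) (ha : φ a = 0)
    (hb : φ b = 0) :
    c ^ 2 * ∫ t in a..b, φ t ^ 2 ≤ ∫ t in a..b, deriv φ t ^ 2 := by
  have hcos : ∀ t ∈ Set.Icc a b, 0 < Real.cos (c * (t - (a + b) / 2)) := by
    intro t ht
    apply Real.cos_pos_of_mem_Ioo
    constructor <;> nlinarith [ht.1, ht.2]
  have hF : ∀ t ∈ Set.Icc a b, HasDerivAt
      (fun t => -c * Real.tan (c * (t - (a + b) / 2)) * φ t ^ 2)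
      (-c * (1 / Real.cos (c * (t - (a + b) / 2)) ^ 2 * c) * φ t ^ 2 +
        -c * Real.tan (c * (t - (a + b) / 2)) * (2 * φ t * deriv φ t)) t := by
    intro t ht
    have h0 : HasDerivAt (fun t => c * (t - (a + b) / 2)) c t := by
      simpa using ((hasDerivAt_id t).sub_const ((a + b) / 2)).const_mul c
    have h1 := ((Real.hasDerivAt_tan (hcos t ht).ne').comp t h0).const_mul (-c)
    have h2 := ((hφ.differentiable one_ne_zero t).hasDerivAt).pow 2
    refine (h1.mul h2).congr_deriv ?_
    simp
  have hc1 : Continuous fun t => deriv φ t ^ 2 := (hφ.continuous_deriv le_rfl).pow 2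
  have hc2 : Continuous fun t => φ t ^ 2 := hφ.continuous.pow 2
  have key := sub_le_integral_of_hasDeriv_right_of_le hab
    (fun t ht => (hF t ht).continuousAt.continuousWithinAt)
    (fun t ht => (hF t (Set.Ioo_subset_Icc_self ht)).hasDerivWithinAt)
    (φ := fun t => deriv φ t ^ 2 - c ^ 2 * φ t ^ 2)
    ((hc1.sub (hc2.const_mul _)).integrableOn_Icc) ?_
  · rw [integral_sub (hc1.intervalIntegrable _ _) ((hc2.const_mul _).intervalIntegrable _ _),
      intervalIntegral.integral_const_mul, ha, hb] at key
    linarith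
  · intro t ht
    have h := hcos t (Set.Ioo_subset_Icc_self ht)
    have h1 : 1 / Real.cos (c * (t - (a + b) / 2)) ^ 2 =
        1 + Real.tan (c * (t - (a + b) / 2)) ^ 2 := by
      rw [one_div, ← Real.inv_one_add_tan_sq h.ne', inv_inv]
    rw [h1]
    nlinarith [sq_nonneg (deriv φ t + c * Real.tan (c * (t - (a + b) / 2)) * φ t)]

/-- Sharp Poincaré inequality on an interval with Dirichlet boundary conditions. -/
lemma sq_mul_integral_sq_le {a b c : ℝ} (hab : a ≤ b) (hc : 0 < c)
    (hcab : c * (b - a) ≤ Real.pi) {φ : ℝ → ℝ} (hφ : ContDiff ℝ 1 φ) (ha : φ a = 0)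
    (hb : φ b = 0) :
    c ^ 2 * ∫ t in a..b, φ t ^ 2 ≤ ∫ t in a..b, deriv φ t ^ 2 := by
  have ht : Filter.Tendsto (fun d : ℝ => d ^ 2 * ∫ t in a..b, φ t ^ 2) (nhdsWithin c (Set.Iio c))
      (nhds (c ^ 2 * ∫ t in a..b, φ t ^ 2)) :=
    (Continuous.tendsto (by fun_prop) c).mono_left nhdsWithin_le_nhds
  refine le_of_tendsto ht ?_
  filter_upwards [Ioo_mem_nhdsLT hc] with d hd
  refine sq_mul_integral_sq_le_of_lt hab hd.1.le ?_ hφ ha hb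
  rcases hab.eq_or_lt with rfl | h
  · simpa using Real.pi_pos
  · nlinarith [hd.2]

/-- The `T`-periodic function agreeing with `f` (shifted by `a`) on `[a, a + T)`. -/
noncomputable def periodize (T a : ℝ) (f : ℝ → ℝ) (θ : ℝ) : ℝ :=
  f (T * Int.fract ((θ - a) / T))

lemma periodize_periodic {T : ℝ} (hT : 0 < T) (a : ℝ) (f : ℝ → ℝ) :
    Function.Periodic (periodize T a f) T := by
  intro θ
  rw [periodize, periodize, show (θ + T - a) / T = (θ - a) / T + 1 by field_simp; ring,
    Int.fract_add_one]

lemma periodize_eq_of_mem_Ico {T a θ : ℝ} (hT : 0 < T) (f : ℝ → ℝ) (n : ℤ)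
    (hθ : θ - a - n * T ∈ Set.Ico 0 T) : periodize T a f θ = f (θ - a - n * T) := by
  have h : Int.fract ((θ - a) / T) = (θ - a - n * T) / T := by
    rw [Int.fract_eq_iff]
    refine ⟨div_nonneg hθ.1 hT.le, (div_lt_one hT).2 hθ.2, n, ?_⟩
    field_simp
    ring
  rw [periodize, h, mul_div_cancel₀ _ hT.ne']

lemma periodize_eq_of_mem_Ioo {T a θ δ : ℝ} (hT : 0 < T) (hδT : δ ≤ T) {f : ℝ → ℝ}
    (h0 : ∀ t ∈ Set.Icc (-δ) 0, f t = 0) (h1 : ∀ t ∈ Set.Icc (T - δ) T, f t = 0) (n : ℤ)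
    (hθ : θ - a - n * T ∈ Set.Ioo (-δ) T) : periodize T a f θ = f (θ - a - n * T) := by
  rcases le_or_gt 0 (θ - a - n * T) with h | h
  · exact periodize_eq_of_mem_Ico hT f n ⟨h, hθ.2⟩
  · rw [periodize_eq_of_mem_Ico hT f (n - 1), h0 _ ⟨hθ.1.le, h.le⟩, h1]
    · push_cast
      constructor <;> linarith [hθ.1]
    · push_cast
      constructor <;> linarith [hθ.1]

lemma contDiff_periodize {T a δ : ℝ} (hT : 0 < T) (hδ : 0 < δ) (hδT : δ ≤ T) {f : ℝ → ℝ}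
    (hf : ContDiff ℝ 1 f)
    (h0 : ∀ t ∈ Set.Icc (-δ) 0, f t = 0) (h1 : ∀ t ∈ Set.Icc (T - δ) T, f t = 0) :
    ContDiff ℝ 1 (periodize T a f) := by
  rw [contDiff_iff_contDiffAt]
  intro θ
  set n := ⌊(θ - a) / T⌋
  have hn1 : n * T ≤ θ - a := (le_div_iff₀ hT).1 (Int.floor_le ((θ - a) / T))
  have hn2 : θ - a < (n + 1) * T := (div_lt_iff₀ hT).1 (Int.lt_floor_add_one ((θ - a) / T))
  have hg : ContDiff ℝ 1 fun x => f (x - a - n * T) := hf.comp (by fun_prop)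
  refine hg.contDiffAt.congr_of_eventuallyEq ?_
  filter_upwards [Ioo_mem_nhds (show a + n * T - δ < θ by linarith)
    (show θ < a + n * T + T by linarith)] with x hx
  refine periodize_eq_of_mem_Ioo hT hδT h0 h1 n ⟨?_, ?_⟩ <;> linarith [hx.1, hx.2]

lemma integral_periodize_sq {T : ℝ} (hT : 0 < T) (a : ℝ) (f : ℝ → ℝ) :
    ∫ θ in (0 : ℝ)..T, periodize T a f θ ^ 2 = ∫ t in (0 : ℝ)..T, f t ^ 2 := by
  have hper : Function.Periodic (fun θ => periodize T a f θ ^ 2) T := fun θ => by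
    simp only [periodize_periodic hT a f θ]
  have h := hper.intervalIntegral_add_eq 0 a
  rw [zero_add] at h
  have h2 := integral_comp_sub_right (a := a) (b := a + T) (fun t => f t ^ 2) a
  rw [sub_self, add_sub_cancel_left] at h2
  rw [h, ← h2]
  refine integral_congr_Ioo_of_le (by linarith) fun θ hθ => ?_
  have := periodize_eq_of_mem_Ico (a := a) (θ := θ) hT f 0
    (by constructor <;> push_cast <;> linarith [hθ.1, hθ.2])
  simp only [this, Int.cast_zero, zero_mul, sub_zero]

lemma integral_deriv_periodize_sq {T : ℝ} (hT : 0 < T) (a : ℝ) (f : ℝ → ℝ) :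
    ∫ θ in (0 : ℝ)..T, deriv (periodize T a f) θ ^ 2 = ∫ t in (0 : ℝ)..T, deriv f t ^ 2 := by
  have hper : Function.Periodic (fun θ => deriv (periodize T a f) θ ^ 2) T := fun θ => by
    have : deriv (periodize T a f) (θ + T) = deriv (periodize T a f) θ := by
      rw [← deriv_comp_add_const]
      congr 1
      exact funext (periodize_periodic hT a f)
    simp only [this]
  have h := hper.intervalIntegral_add_eq 0 a
  rw [zero_add] at h
  have h2 := integral_comp_sub_right (a := a) (b := a + T) (fun t => deriv f t ^ 2) a
  rw [sub_self, add_sub_cancel_left] at h2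
  rw [h, ← h2]
  refine integral_congr_Ioo_of_le (by linarith) fun θ hθ => ?_
  have : periodize T a f =ᶠ[nhds θ] fun x => f (x - a) := by
    filter_upwards [Ioo_mem_nhds hθ.1 hθ.2] with x hx
    have := periodize_eq_of_mem_Ico (a := a) (θ := x) hT f 0
      (by constructor <;> push_cast <;> linarith [hx.1, hx.2])
    simpa using this
  simp only [this.deriv_eq, deriv_comp_sub_const]

lemma continuous_periodize {T : ℝ} (a : ℝ) {f : ℝ → ℝ} (hf : Continuous f)
    (h : f 0 = f T) : Continuous (periodize T a f) := by
  have h1 : Continuous ((fun x => f (T * x)) ∘ (Int.fract : ℝ → ℝ)) :=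
    ContinuousOn.comp_fract'' (by fun_prop) (by simpa using h)
  exact h1.comp (by fun_prop : Continuous fun θ => (θ - a) / T)

lemma sinPosPow_eq_zero_left {c p : ℝ} (hc : 0 < c) (hc1 : c ≤ 1) (hp : p ≠ 0) :
    ∀ t ∈ Set.Icc (-(2 * Real.pi - Real.pi / c)) 0, sinPosPow c p t = 0 := by
  intro t ht
  have h : c * (Real.pi / c) = Real.pi := mul_div_cancel₀ _ hc.ne'
  refine sinPosPow_of_nonpos hp (Real.sin_nonpos_of_nonpos_of_neg_pi_le ?_ ?_)
  · nlinarith [ht.2]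
  · nlinarith [ht.1, Real.pi_pos, mul_le_mul_of_nonneg_left ht.1 hc.le]

lemma sinPosPow_eq_zero_right {c p : ℝ} (hc : 0 < c) (hc1 : c ≤ 1) (hp : p ≠ 0) :
    ∀ t ∈ Set.Icc (2 * Real.pi - (2 * Real.pi - Real.pi / c)) (2 * Real.pi),
      sinPosPow c p t = 0 := by
  intro t ht
  have h : c * (Real.pi / c) = Real.pi := mul_div_cancel₀ _ hc.ne'
  refine sinPosPow_of_nonpos hp ?_
  rw [← Real.sin_sub_two_pi]
  apply Real.sin_nonpos_of_nonpos_of_neg_pi_le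
  · nlinarith [ht.1, ht.2, Real.pi_pos, mul_le_mul_of_nonneg_left ht.2 hc.le]
  · nlinarith [ht.1, Real.pi_pos, mul_le_mul_of_nonneg_left ht.1 hc.le]

/-- A continuous periodic function vanishing a.e. on the zero set of `u` within one period
vanishes at every interior point of that zero set. -/
lemma eq_zero_of_eventually_zero {φ u : ℝ → ℝ} {T : ℝ} (hT : 0 < T) (hφ : Continuous φ)
    (hφT : Function.Periodic φ T) (huT : Function.Periodic u T)
    (hnull : volume ({θ | φ θ ≠ 0} ∩ {θ | u θ = 0} ∩ Set.Ico 0 T) = 0) {θ : ℝ}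
    (hu : ∀ᶠ x in nhds θ, u x = 0) : φ θ = 0 := by
  obtain ⟨n, hn, -⟩ := existsUnique_add_zsmul_mem_Ico hT θ 0
  rw [zero_add] at hn
  set x := θ + n • T with hx
  have hφx : φ x = φ θ := hφT.zsmul n θ
  have hux : ∀ᶠ y in nhds x, u y = 0 := by
    have h : Filter.Tendsto (fun y => y - n • T) (nhds x) (nhds θ) := by
      have := (by fun_prop : Continuous fun y : ℝ => y - n • T).tendsto x
      rwa [hx, add_sub_cancel_right] at this
    filter_upwards [h.eventually hu] with y hy
    rwa [huT.sub_zsmul_eq] at hy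
  rw [← hφx]
  by_contra hne
  have hmem : {θ | φ θ ≠ 0} ∩ {θ | u θ = 0} ∩ Set.Ico 0 T ∈ nhdsWithin x (Set.Ioi x) := by
    filter_upwards [(hφ.continuousAt.eventually_ne hne).filter_mono nhdsWithin_le_nhds,
      hux.filter_mono nhdsWithin_le_nhds, Ioo_mem_nhdsGT hn.2] with y h1 h2 h3
    exact ⟨⟨h1, h2⟩, hn.1.trans h3.1.le, h3.2⟩
  obtain ⟨y, hy, hsub⟩ := (mem_nhdsGT_iff_exists_Ioo_subset).1 hmem
  have h0 := measure_mono_null hsub hnull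
  rw [Real.volume_Ioo, ENNReal.ofReal_eq_zero] at h0
  have : x < y := hy
  linarith

/-- The Rayleigh quotient of an admissible test function on an arc of length `π / c` is at
least `c ^ 2`. -/
lemma sq_mul_integral_sq_le_of_null {c a : ℝ} (hc : 1 / 2 < c) (hc1 : c ≤ 1) {φ : ℝ → ℝ}
    (hφ : ContDiff ℝ 1 φ) (hper : Function.Periodic φ (2 * Real.pi))
    (hnull : volume ({θ | φ θ ≠ 0} ∩ {θ | periodize (2 * Real.pi) a (sinPosPow c 1) θ = 0} ∩
      Set.Ico 0 (2 * Real.pi)) = 0) :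
    c ^ 2 * ∫ θ in (0 : ℝ)..(2 * Real.pi), φ θ ^ 2 ≤
      ∫ θ in (0 : ℝ)..(2 * Real.pi), deriv φ θ ^ 2 := by
  have hc0 : 0 < c := by linarith
  have hT : 0 < 2 * Real.pi := by positivity
  have hL : 0 < Real.pi / c := by positivity
  have hcL : c * (Real.pi / c) = Real.pi := mul_div_cancel₀ _ hc0.ne'
  have hL2 : Real.pi / c < 2 * Real.pi := by
    rw [div_lt_iff₀ hc0]
    nlinarith [Real.pi_pos]
  have hzero : Set.Ioo (a + Real.pi / c) (a + 2 * Real.pi) ⊆ {θ | φ θ = 0} := by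
    intro θ hθ
    refine eq_zero_of_eventually_zero hT hφ.continuous hper (periodize_periodic hT _ _) hnull ?_
    filter_upwards [Ioo_mem_nhds hθ.1 hθ.2] with x hx
    rw [periodize_eq_of_mem_Ico hT _ 0]
    · refine sinPosPow_eq_zero_right hc0 hc1 one_ne_zero _ ⟨?_, ?_⟩ <;> push_cast <;>
        linarith [hx.1, hx.2]
    · constructor <;> push_cast <;> linarith [hx.1, hx.2]
  have hzero' : Set.Icc (a + Real.pi / c) (a + 2 * Real.pi) ⊆ {θ | φ θ = 0} := by
    rw [← closure_Ioo (by linarith)]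
    exact closure_minimal hzero (isClosed_eq hφ.continuous continuous_const)
  have hca : φ a = 0 := by
    rw [← hper a]
    exact hzero' ⟨by linarith, le_rfl⟩
  have hcb : φ (a + Real.pi / c) = 0 := hzero' ⟨le_rfl, by linarith⟩
  have hd1 : Continuous fun t => deriv φ t ^ 2 := (hφ.continuous_deriv le_rfl).pow 2
  have hd2 : Continuous fun t => φ t ^ 2 := hφ.continuous.pow 2
  have hper1 : Function.Periodic (fun θ => deriv φ θ ^ 2) (2 * Real.pi) := fun θ => by
    have : deriv φ (θ + 2 * Real.pi) = deriv φ θ := by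
      rw [← deriv_comp_add_const]
      congr 1
      exact funext hper
    simp only [this]
  have hper2 : Function.Periodic (fun θ => φ θ ^ 2) (2 * Real.pi) := fun θ => by
    simp only [hper θ]
  have e1 := hper1.intervalIntegral_add_eq 0 a
  have e2 := hper2.intervalIntegral_add_eq 0 a
  rw [zero_add] at e1 e2
  rw [e1, e2, ← integral_add_adjacent_intervals (hd1.intervalIntegrable a (a + Real.pi / c))
    (hd1.intervalIntegrable _ _), ← integral_add_adjacent_intervals
    (hd2.intervalIntegrable a (a + Real.pi / c)) (hd2.intervalIntegrable _ _)]
  have z2 : ∫ θ in (a + Real.pi / c)..(a + 2 * Real.pi), φ θ ^ 2 = 0 := by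
    rw [integral_congr_Ioo_of_le (g := fun _ => 0) (by linarith)]
    · simp
    · intro θ hθ
      have : φ θ = 0 := hzero hθ
      simp [this]
  have z1 : 0 ≤ ∫ θ in (a + Real.pi / c)..(a + 2 * Real.pi), deriv φ θ ^ 2 :=
    integral_nonneg (by linarith) fun θ _ => sq_nonneg _
  have := sq_mul_integral_sq_le (a := a) (b := a + Real.pi / c) (by linarith) hc0
    (by rw [add_sub_cancel_left, hcL]) hφ hca hcb
  rw [z2, add_zero]
  linarith

/-- The first Dirichlet eigenvalue of an arc of length `π / c` is `c ^ 2`. -/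
lemma lamCirc_periodize_sinPosPow {c : ℝ} (hc : 1 / 2 < c) (hc1 : c ≤ 1) (a : ℝ) :
    lamCirc (periodize (2 * Real.pi) a (sinPosPow c 1)) = c ^ 2 := by
  have hc0 : 0 < c := by linarith
  have hT : 0 < 2 * Real.pi := by positivity
  have hL : 0 < Real.pi / c := by positivity
  have hL2 : Real.pi / c < 2 * Real.pi := by
    rw [div_lt_iff₀ hc0]
    nlinarith [Real.pi_pos]
  have hend : Real.sin (c * (2 * Real.pi)) ≤ 0 := by
    rw [← Real.sin_sub_two_pi]
    apply Real.sin_nonpos_of_nonpos_of_neg_pi_le <;> nlinarith [Real.pi_pos]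
  have hmem : ∀ p : ℝ, 1 < p → p ^ 2 * c ^ 2 / (2 * p - 1) ∈ { c' : ℝ | ∃ φ : ℝ → ℝ,
      ContDiff ℝ 1 φ ∧ Function.Periodic φ (2 * Real.pi) ∧
      volume ({θ | φ θ ≠ 0} ∩ {θ | periodize (2 * Real.pi) a (sinPosPow c 1) θ = 0} ∩
        Set.Ico 0 (2 * Real.pi)) = 0 ∧
      0 < ∫ θ in (0 : ℝ)..(2 * Real.pi), (φ θ) ^ 2 ∧
      c' = (∫ θ in (0 : ℝ)..(2 * Real.pi), (deriv φ θ) ^ 2) /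
        (∫ θ in (0 : ℝ)..(2 * Real.pi), (φ θ) ^ 2) } := by
    intro p hp
    have hp0 : p ≠ 0 := by linarith
    have hpos : 0 < ∫ t in (0 : ℝ)..(2 * Real.pi), sinPosPow c p t ^ 2 := by
      refine integral_pos hT ((continuous_sinPosPow (by linarith)).pow 2).continuousOn
        (fun _ _ => sq_nonneg _) ⟨Real.pi / c / 2, ⟨by positivity, by linarith⟩, ?_⟩
      rw [sinPosPow, show c * (Real.pi / c / 2) = Real.pi / 2 by field_simp, Real.sin_pi_div_two]
      simp
    refine ⟨periodize (2 * Real.pi) a (sinPosPow c p), ?_, periodize_periodic hT _ _, ?_, ?_, ?_⟩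
    · exact contDiff_periodize hT (δ := 2 * Real.pi - Real.pi / c) (by linarith) (by linarith)
        (contDiff_sinPosPow hp) (sinPosPow_eq_zero_left hc0 hc1 hp0)
        (sinPosPow_eq_zero_right hc0 hc1 hp0)
    · convert measure_empty (μ := (volume : Measure ℝ))
      refine Set.eq_empty_of_forall_notMem fun θ hθ => hθ.1.1 ?_
      have h : periodize (2 * Real.pi) a (sinPosPow c 1) θ = 0 := hθ.1.2
      rw [periodize, sinPosPow, Real.rpow_one] at h
      rw [periodize, sinPosPow, h, Real.zero_rpow hp0]
    · rwa [integral_periodize_sq hT]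
    · rw [integral_periodize_sq hT, integral_deriv_periodize_sq hT,
        integral_deriv_sinPosPow_sq hc0.ne' hp hend, mul_div_cancel_right₀ _ hpos.ne']
  apply le_antisymm
  · have ht : Filter.Tendsto (fun p : ℝ => p ^ 2 * c ^ 2 / (2 * p - 1))
        (nhdsWithin 1 (Set.Ioi 1)) (nhds (c ^ 2)) := by
      have : ContinuousAt (fun p : ℝ => p ^ 2 * c ^ 2 / (2 * p - 1)) 1 :=
        ContinuousAt.div (by fun_prop) (by fun_prop) (by norm_num)
      have h := this.tendsto
      norm_num at h
      exact h.mono_left nhdsWithin_le_nhds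
    refine ge_of_tendsto ht ?_
    filter_upwards [self_mem_nhdsWithin] with p hp
    refine csInf_le ⟨0, ?_⟩ (hmem p hp)
    rintro _ ⟨φ, -, -, -, hpos, rfl⟩
    exact div_nonneg (integral_nonneg hT.le fun _ _ => sq_nonneg _) hpos.le
  · refine le_csInf ⟨_, hmem 2 one_lt_two⟩ ?_
    rintro _ ⟨φ, hφ, hper, hnull, hpos, rfl⟩
    rw [le_div_iff₀ hpos]
    exact sq_mul_integral_sq_le_of_null hc hc1 hφ hper hnull

/-- The `k` rotations by `2π / k` of the zero arc of length `2π / k` cover the circle. -/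
lemma exists_rotation_mem_arc {k : ℕ} (hk : 0 < k) (θ : ℝ) :
    ∃ (m : Fin k) (n : ℤ), θ - (m : ℝ) * (2 * Real.pi) / k - n * (2 * Real.pi) ∈
      Set.Ico (2 * Real.pi - 2 * Real.pi / k) (2 * Real.pi) := by
  have hk0 : (0 : ℝ) < k := by exact_mod_cast hk
  have hkz : (k : ℤ) ≠ 0 := by exact_mod_cast hk.ne'
  set x := θ * k / (2 * Real.pi) with hx
  set j := ⌊x⌋ + 1 with hj
  have hθ : θ = x / k * (2 * Real.pi) := by
    rw [hx]
    field_simp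
  have hlt : (j % k).toNat < k := by
    have := Int.emod_lt_of_pos j (show (0 : ℤ) < k by exact_mod_cast hk)
    have := Int.emod_nonneg j hkz
    omega
  refine ⟨⟨(j % k).toNat, hlt⟩, j / k - 1, ?_⟩
  have hcast : (((j % k).toNat : ℕ) : ℝ) = j - k * ((j / k : ℤ) : ℝ) := by
    have h1 : (((j % k).toNat : ℕ) : ℤ) = j - k * (j / k) := by
      rw [Int.toNat_of_nonneg (Int.emod_nonneg j hkz), Int.emod_def]
    exact_mod_cast congrArg (Int.cast : ℤ → ℝ) h1
  have e : θ - (((j % k).toNat : ℕ) : ℝ) * (2 * Real.pi) / k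
      - ((j / k - 1 : ℤ) : ℝ) * (2 * Real.pi) =
      2 * Real.pi - 2 * Real.pi / k * (j - x) := by
    rw [hcast, hθ]
    push_cast
    field_simp
    ring
  have h1 : (j : ℝ) - x ≤ 1 := by
    rw [hj]
    push_cast
    linarith [Int.floor_le x]
  have h2 : 0 < (j : ℝ) - x := by
    rw [hj]
    push_cast
    linarith [Int.lt_floor_add_one x]
  have hp : 0 < 2 * Real.pi / k := by positivity
  simp only [e]
  constructor <;> nlinarith

/-- In dimension `N = 2`: the function `u_1(θ) = sin(kθ/(2(k-1)))` on
`[0, 2π(k-1)/k]`, extended by `0` and periodized, together with its rotations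
by multiples of `2π/k`, has vanishing product on the circle, each rotation has
`λ(u_m) = k²/(4(k-1)²)`, and hence `α_{k,2} ≤ k²/(2(k-1))`. -/
theorem stmt4 (k : ℕ) (hk : 2 ≤ k)
    (base : ℝ → ℝ)
    (hbase : ∀ t : ℝ, base t =
      if t ∈ Set.Icc (0 : ℝ) (2 * Real.pi * ((k : ℝ) - 1) / k) then
        Real.sin ((k : ℝ) / (2 * ((k : ℝ) - 1)) * t)
      else 0)
    (u : Fin k → ℝ → ℝ)
    (hu : ∀ (m : Fin k) (θ : ℝ), u m θ =
      base (2 * Real.pi * Int.fract ((θ - (m : ℝ) * (2 * Real.pi) / k) / (2 * Real.pi)))) :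
    (∀ θ : ℝ, ∏ m, u m θ = 0) ∧
    (∀ m, lamCirc (u m) = (k : ℝ) ^ 2 / (4 * ((k : ℝ) - 1) ^ 2)) ∧
    alphaCirc k ≤ (k : ℝ) ^ 2 / (2 * ((k : ℝ) - 1)) := by
  have hk2 : (2 : ℝ) ≤ k := by exact_mod_cast hk
  have hk1 : (0 : ℝ) < (k : ℝ) - 1 := by linarith
  have hT : 0 < 2 * Real.pi := by positivity
  set c : ℝ := (k : ℝ) / (2 * ((k : ℝ) - 1)) with hcdef
  have hc : 1 / 2 < c := by
    rw [hcdef, div_lt_div_iff₀ (by norm_num) (by positivity)]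
    linarith
  have hc1 : c ≤ 1 := by
    rw [hcdef, div_le_one (by positivity)]
    linarith
  have hc0 : 0 < c := by linarith
  have hcsq : c ^ 2 = (k : ℝ) ^ 2 / (4 * ((k : ℝ) - 1) ^ 2) := by
    rw [hcdef, div_pow, mul_pow]
    norm_num
  have hL : 2 * Real.pi * ((k : ℝ) - 1) / k = Real.pi / c := by
    rw [hcdef]
    field_simp
  have harc : 2 * Real.pi - 2 * Real.pi / k = Real.pi / c := by
    rw [← hL]
    field_simp
  have hcL : c * (Real.pi / c) = Real.pi := mul_div_cancel₀ _ hc0.ne'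
  have hbase' : ∀ t ∈ Set.Ico 0 (2 * Real.pi), base t = sinPosPow c 1 t := by
    intro t ht
    rw [hbase, hL]
    split_ifs with h
    · rw [sinPosPow, Real.rpow_one, max_eq_left]
      apply Real.sin_nonneg_of_nonneg_of_le_pi (mul_nonneg hc0.le h.1)
      rw [← hcL]
      exact mul_le_mul_of_nonneg_left h.2 hc0.le
    · have hlt : Real.pi / c < t := by
        by_contra hle
        exact h ⟨ht.1, not_lt.1 hle⟩
      exact (sinPosPow_eq_zero_right hc0 hc1 one_ne_zero t ⟨by linarith, ht.2.le⟩).symm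
  have hu' : ∀ m : Fin k, u m =
      periodize (2 * Real.pi) ((m : ℝ) * (2 * Real.pi) / k) (sinPosPow c 1) := by
    intro m
    funext θ
    rw [hu, periodize, hbase']
    exact ⟨mul_nonneg hT.le (Int.fract_nonneg _),
      mul_lt_of_lt_one_right hT (Int.fract_lt_one _)⟩
  have hprod : ∀ θ : ℝ, ∏ m, u m θ = 0 := by
    intro θ
    obtain ⟨m, n, hmn⟩ := exists_rotation_mem_arc (k := k) (by omega) θ
    refine Finset.prod_eq_zero (Finset.mem_univ m) ?_
    rw [harc] at hmn
    have hL0 : 0 < Real.pi / c := by positivity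
    rw [hu', periodize_eq_of_mem_Ico hT _ n ⟨hL0.le.trans hmn.1, hmn.2⟩]
    exact sinPosPow_eq_zero_right hc0 hc1 one_ne_zero _ ⟨by linarith [hmn.1], hmn.2.le⟩
  have hlam : ∀ m, lamCirc (u m) = c ^ 2 := fun m => by
    rw [hu', lamCirc_periodize_sinPosPow hc hc1]
  refine ⟨hprod, fun m => (hlam m).trans hcsq, csInf_le ⟨0, ?_⟩ ⟨u, ?_, ?_, hprod, ?_⟩⟩
  · rintro _ ⟨v, -, -, -, rfl⟩
    exact Finset.sum_nonneg fun _ _ => Real.sqrt_nonneg _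
  · intro m
    rw [hu']
    refine continuous_periodize _ (continuous_sinPosPow zero_le_one) ?_
    rw [sinPosPow_of_nonpos one_ne_zero (by simp), sinPosPow_eq_zero_right hc0 hc1 one_ne_zero]
    have : Real.pi / c ≤ 2 * Real.pi := by
      rw [← harc]
      have : 0 < 2 * Real.pi / k := by positivity
      linarith
    exact ⟨by linarith, le_rfl⟩
  · intro m
    rw [hu']
    exact periodize_periodic hT _ _
  · simp only [hlam, Real.sqrt_sq hc0.le, Finset.sum_const, Finset.card_univ, Fintype.card_fin,
      nsmul_eq_mul]
    rw [hcdef]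
    ring
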